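/- Let M ≥ 1, let K : ℕ → ℕ → ℝ be a symmetric kernel (K i j = K j i for all i, j), and let n : ℕ → ℝ be any vector of concentrations. Define the truncated Smoluchowski aggregation operator by S_s(n) = (1/2)·Σ_{i+j=s, i,j≥1} K(i,j)·n_i·n_j − n_s·Σ_{i=1}^{M} K(s,i)·n_i for 1 ≤ s ≤ M. Then the total mass flux satisfies the exact identity Σ_{s=1}^{M} s·S_s(n) = −(1/2)·Σ_{i=1}^{M} Σ_{j=1}^{M} [i+j>M]·(i+j)·K(i,j)·n_i·n_j, where [i+j>M] equals 1 if i+j>M and 0 otherwise. -/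

import Mathlib

theorem gain_reindex (M : ℕ) (F : ℕ → ℕ → ℝ) :
    ∑ s ∈ Finset.Icc 1 M, ∑ i ∈ Finset.Ico 1 s, F i (s - i) =
      ∑ i ∈ Finset.Icc 1 M, ∑ j ∈ Finset.Icc 1 M, (if M < i + j then 0 else F i j) := by
  have h : ∀ i j : ℕ, (if M < i + j then 0 else F i j) = if i + j ≤ M then F i j else 0 := by
    intro i j
    by_cases h : M < i + j
    · rw [if_pos h, if_neg (by omega)]
    · rw [if_neg h, if_pos (by omega)]
  simp only [h]
  simp only [← Finset.sum_filter]
  rw [Finset.sum_sigma', Finset.sum_sigma']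
  refine Finset.sum_bij' (fun p _ => ⟨p.2, p.1 - p.2⟩) (fun p _ => ⟨p.1 + p.2, p.1⟩) ?_ ?_ ?_ ?_ ?_
  · rintro ⟨s, i⟩ hp
    simp only [Finset.mem_sigma, Finset.mem_Icc, Finset.mem_Ico, Finset.mem_filter] at hp ⊢
    omega
  · rintro ⟨i, j⟩ hp
    simp only [Finset.mem_sigma, Finset.mem_Icc, Finset.mem_Ico, Finset.mem_filter] at hp ⊢
    omega
  · rintro ⟨s, i⟩ hp
    simp only [Finset.mem_sigma, Finset.mem_Icc, Finset.mem_Ico] at hp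
    have : i + (s - i) = s := by omega
    simp [this]
  · rintro ⟨i, j⟩ hp
    simp
  · rintro ⟨s, i⟩ hp
    rfl

/-- Mass flux identity for the truncated Smoluchowski aggregation operator:
`Σ_{s=1}^M s·S_s(n) = -(1/2)·Σ_{i=1}^M Σ_{j=1}^M [i+j>M]·(i+j)·K(i,j)·n_i·n_j`. -/
theorem truncated_smoluchowski_mass_flux
    (M : ℕ) (hM : 1 ≤ M)
    (K : ℕ → ℕ → ℝ) (hK : ∀ i j, K i j = K j i)
    (n : ℕ → ℝ) (S : ℕ → ℝ)
    (hS : ∀ s ∈ Finset.Icc 1 M,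
      S s = (1 / 2) * ∑ i ∈ Finset.Ico 1 s, K i (s - i) * n i * n (s - i)
            - n s * ∑ i ∈ Finset.Icc 1 M, K s i * n i) :
    ∑ s ∈ Finset.Icc 1 M, (s : ℝ) * S s =
      -(1 / 2) * ∑ i ∈ Finset.Icc 1 M, ∑ j ∈ Finset.Icc 1 M,
        (if M < i + j then ((i : ℝ) + j) * K i j * n i * n j else 0) := by
  have hgain := gain_reindex M (fun i j => ((i : ℝ) + j) * K i j * n i * n j)
  have e1 : ∑ s ∈ Finset.Icc 1 M, (s : ℝ) * S s =
      (1 / 2) * (∑ s ∈ Finset.Icc 1 M, ∑ i ∈ Finset.Ico 1 s,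
        ((i : ℝ) + ((s - i : ℕ) : ℝ)) * K i (s - i) * n i * n (s - i))
      - ∑ s ∈ Finset.Icc 1 M, ∑ i ∈ Finset.Icc 1 M, (s : ℝ) * K s i * n s * n i := by
    rw [Finset.mul_sum, ← Finset.sum_sub_distrib]
    refine Finset.sum_congr rfl fun s hs => ?_
    rw [hS s hs, mul_sub]
    congr 1
    · rw [mul_left_comm, Finset.mul_sum]
      congr 1
      refine Finset.sum_congr rfl fun i hi => ?_
      rw [Finset.mem_Ico] at hi
      rw [Nat.cast_sub hi.2.le]
      ring
    · rw [Finset.mul_sum, Finset.mul_sum]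
      refine Finset.sum_congr rfl fun i _ => ?_
      ring
  have e2 : ∑ s ∈ Finset.Icc 1 M, ∑ i ∈ Finset.Icc 1 M, (s : ℝ) * K s i * n s * n i =
      ∑ s ∈ Finset.Icc 1 M, ∑ i ∈ Finset.Icc 1 M, (i : ℝ) * K s i * n s * n i := by
    rw [Finset.sum_comm]
    refine Finset.sum_congr rfl fun i _ => Finset.sum_congr rfl fun j _ => ?_
    rw [hK j i]
    ring
  have e3 : ∑ i ∈ Finset.Icc 1 M, ∑ j ∈ Finset.Icc 1 M,
        (if M < i + j then 0 else ((i : ℝ) + j) * K i j * n i * n j)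
      + ∑ i ∈ Finset.Icc 1 M, ∑ j ∈ Finset.Icc 1 M,
        (if M < i + j then ((i : ℝ) + j) * K i j * n i * n j else 0)
      = ∑ s ∈ Finset.Icc 1 M, ∑ i ∈ Finset.Icc 1 M, (s : ℝ) * K s i * n s * n i
      + ∑ s ∈ Finset.Icc 1 M, ∑ i ∈ Finset.Icc 1 M, (i : ℝ) * K s i * n s * n i := by
    simp only [← Finset.sum_add_distrib]
    refine Finset.sum_congr rfl fun i _ => Finset.sum_congr rfl fun j _ => ?_
    split_ifs <;> ring
  rw [e1, hgain]
  linarith
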